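/- Robustness at a fixed measurement: let ρ and σ be states on C^d ⊗ C^d (d ≥ 2), let P be a von Neumann measurement, let 0 ≤ ε ≤ 1, and define M(τ, P) = ( inf over product states δ of H(δ, P) ) − H(τ, P). Then |M(ρ, P) − M((1−ε)·ρ + ε·σ, P)| ≤ 4·ε·log₂ d + H₂(ε), where H₂(ε) = −ε·log₂ ε − (1−ε)·log₂(1−ε). -/

import Mathlib

open Matrix Kronecker BigOperators ComplexOrder

noncomputable section

namespace EEP

/-- `-(x * log₂ x)`; note `Real.logb 2 0 = 0`, giving the convention `0·log₂ 0 = 0`. -/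
def negMulLog2 (x : ℝ) : ℝ := -(x * Real.logb 2 x)

/-- Shannon entropy (base 2) of a finite family of reals. -/
def shannon {n : Type*} [Fintype n] (p : n → ℝ) : ℝ := ∑ i, negMulLog2 (p i)

/-- A quantum state: positive semidefinite (hence Hermitian) matrix with trace 1. -/
def IsState {n : Type*} [Fintype n] [DecidableEq n] (ρ : Matrix n n ℂ) : Prop :=
  ρ.PosSemidef ∧ ρ.trace = 1

/-- A rank-one orthogonal projection matrix. -/
def IsRankOneProj {n : Type*} [Fintype n] [DecidableEq n] (P : Matrix n n ℂ) : Prop :=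
  P.IsHermitian ∧ P * P = P ∧ P.rank = 1

/-- A von Neumann measurement on `C^d ⊗ C^d`: a family of `d²` rank-one orthogonal
projections, mutually orthogonal, summing to the identity. -/
def IsMeasurement {d : ℕ} (P : Fin (d^2) → Matrix (Fin d × Fin d) (Fin d × Fin d) ℂ) : Prop :=
  (∀ i, IsRankOneProj (P i)) ∧ (∀ i j, i ≠ j → P i * P j = 0) ∧ (∑ i, P i) = 1

/-- Klein entropy: Shannon entropy of the outcome distribution `pᵢ = Tr(ρ Pᵢ)`. -/
def kleinEntropy {d : ℕ} (ρ : Matrix (Fin d × Fin d) (Fin d × Fin d) ℂ)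
    (P : Fin (d^2) → Matrix (Fin d × Fin d) (Fin d × Fin d) ℂ) : ℝ :=
  shannon (fun i => (ρ * P i).trace.re)

/-- A product state: Kronecker product of two states on `C^d`. -/
def IsProductState {d : ℕ} (δ : Matrix (Fin d × Fin d) (Fin d × Fin d) ℂ) : Prop :=
  ∃ σA σB : Matrix (Fin d) (Fin d) ℂ, IsState σA ∧ IsState σB ∧ δ = σA ⊗ₖ σB

/-- Infimum of the Klein entropy over product states, for a fixed measurement. -/
def infProd {d : ℕ} (P : Fin (d^2) → Matrix (Fin d × Fin d) (Fin d × Fin d) ℂ) : ℝ :=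
  sInf {x : ℝ | ∃ δ, IsProductState δ ∧ x = kleinEntropy δ P}

/-- The entropic entanglement parameter
`M(ρ) = sup_P ( inf_{δ product} H(δ,P) − H(ρ,P) )`. -/
def eep {d : ℕ} (ρ : Matrix (Fin d × Fin d) (Fin d × Fin d) ℂ) : ℝ :=
  sSup {x : ℝ | ∃ P, IsMeasurement P ∧ x = infProd P - kleinEntropy ρ P}

/-- A separable state: finite convex combination of product states. -/
def IsSeparable {d : ℕ} (ρ : Matrix (Fin d × Fin d) (Fin d × Fin d) ℂ) : Prop :=
  ∃ (m : ℕ) (p : Fin m → ℝ) (δ : Fin m → Matrix (Fin d × Fin d) (Fin d × Fin d) ℂ),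
    (∀ i, 0 ≤ p i) ∧ (∑ i, p i) = 1 ∧ (∀ i, IsProductState (δ i)) ∧
    ρ = ∑ i, (p i : ℂ) • δ i

/-- Rank-one projection `|v⟩⟨v|` onto a vector `v`. -/
def projVec {n : Type*} (v : n → ℂ) : Matrix n n ℂ := Matrix.vecMulVec v (star v)

/-- Coefficient matrix `A` of a vector `ψ ∈ C^d ⊗ C^d`, `A i j = ψ (i,j)`. -/
def coeffMat {d : ℕ} (ψ : Fin d × Fin d → ℂ) : Matrix (Fin d) (Fin d) ℂ :=
  Matrix.of fun i j => ψ (i, j)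

/-- The squared Schmidt coefficients of `ψ`: the eigenvalues of `A Aᴴ`
where `A` is the coefficient matrix of `ψ`. -/
def schmidtSq {d : ℕ} (ψ : Fin d × Fin d → ℂ) : Fin d → ℝ :=
  (Matrix.isHermitian_mul_conjTranspose_self (coeffMat ψ)).eigenvalues

/-- Largest squared Schmidt coefficient (square of the largest singular value of `A`). -/
def maxSchmidtSq {d : ℕ} (ψ : Fin d × Fin d → ℂ) : ℝ := ⨆ i, schmidtSq ψ i

/-- A unit vector. -/
def IsUnitVec {n : Type*} [Fintype n] (ψ : n → ℂ) : Prop := (∑ p, Complex.normSq (ψ p)) = 1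

/-- A maximally entangled unit vector: all squared Schmidt coefficients equal `1/d`. -/
def IsMaxEntVec {d : ℕ} (ψ : Fin d × Fin d → ℂ) : Prop :=
  IsUnitVec ψ ∧ ∀ i, schmidtSq ψ i = 1 / d

/-- A von Neumann measurement in a maximally entangled basis. -/
def IsMaxEntMeasurement {d : ℕ}
    (P : Fin (d^2) → Matrix (Fin d × Fin d) (Fin d × Fin d) ℂ) : Prop :=
  IsMeasurement P ∧ ∀ i, ∃ ψ, IsMaxEntVec ψ ∧ P i = projVec ψ

/-- Von Neumann entropy: Shannon entropy of the eigenvalues. -/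
def vnEntropy {n : Type*} [Fintype n] [DecidableEq n] {ρ : Matrix n n ℂ}
    (h : ρ.IsHermitian) : ℝ := shannon h.eigenvalues

/-- Binary Shannon entropy. -/
def binEnt (x : ℝ) : ℝ := negMulLog2 x + negMulLog2 (1 - x)

theorem nml_eq (x : ℝ) : negMulLog2 x = Real.negMulLog x / Real.log 2 := by
  unfold negMulLog2 Real.negMulLog Real.logb
  ring

theorem nml_mul (a b : ℝ) : negMulLog2 (a * b) = b * negMulLog2 a + a * negMulLog2 b := by
  simp only [nml_eq, Real.negMulLog_mul]
  ring

theorem nml_nonneg {x : ℝ} (h0 : 0 ≤ x) (h1 : x ≤ 1) : 0 ≤ negMulLog2 x := by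
  rw [nml_eq]
  exact div_nonneg (Real.negMulLog_nonneg h0 h1) (Real.log_nonneg (by norm_num))

theorem nml_concave : ConcaveOn ℝ (Set.Ici 0) negMulLog2 := by
  have h := Real.concaveOn_negMulLog.smul (c := (Real.log 2)⁻¹)
    (inv_nonneg.2 (Real.log_nonneg (by norm_num)))
  have e : negMulLog2 = fun x => (Real.log 2)⁻¹ • Real.negMulLog x := by
    funext x
    simp [nml_eq, div_eq_inv_mul]
  rw [e]
  exact h

theorem nml_subadd {x y : ℝ} (hx : 0 ≤ x) (hy : 0 ≤ y) :
    negMulLog2 (x + y) ≤ negMulLog2 x + negMulLog2 y := by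
  unfold negMulLog2
  have key : ∀ a b : ℝ, 0 ≤ a → 0 ≤ b → a * Real.logb 2 a ≤ a * Real.logb 2 (a + b) := by
    intro a b ha hb
    rcases ha.eq_or_lt with h | h
    · simp [← h]
    · exact mul_le_mul_of_nonneg_left
        (Real.logb_le_logb_of_le (by norm_num) h (by linarith)) ha
  have h1 := key x y hx hy
  have h2 := key y x hy hx
  rw [add_comm y x] at h2
  nlinarith

theorem shannon_le {n : ℕ} (hn : 0 < n) (p : Fin n → ℝ) (hp : ∀ i, 0 ≤ p i)
    (hs : ∑ i, p i = 1) : shannon p ≤ Real.logb 2 n := by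
  have hn' : (0 : ℝ) < n := by exact_mod_cast hn
  have h := nml_concave.le_map_sum (t := Finset.univ) (w := fun _ : Fin n => (n : ℝ)⁻¹) (p := p)
    (fun i _ => by positivity) (by simp [hn'.ne']) (fun i _ => hp i)
  simp only [smul_eq_mul, ← Finset.mul_sum, hs, mul_one] at h
  have h2 : negMulLog2 (n : ℝ)⁻¹ = (n : ℝ)⁻¹ * Real.logb 2 n := by
    unfold negMulLog2
    rw [Real.logb_inv]; ring
  rw [h2] at h
  exact le_of_mul_le_mul_left h (by positivity)

theorem shannon_nonneg {n : ℕ} (p : Fin n → ℝ) (hp : ∀ i, 0 ≤ p i)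
    (hs : ∑ i, p i = 1) : 0 ≤ shannon p := by
  refine Finset.sum_nonneg fun i _ => nml_nonneg (hp i) ?_
  rw [← hs]
  exact Finset.single_le_sum (fun j _ => hp j) (Finset.mem_univ i)

theorem probs {d : ℕ} (ρ : Matrix (Fin d × Fin d) (Fin d × Fin d) ℂ) (hρ : IsState ρ)
    (P : Fin (d^2) → Matrix (Fin d × Fin d) (Fin d × Fin d) ℂ) (hP : IsMeasurement P) :
    (∀ i, 0 ≤ (ρ * P i).trace.re) ∧ ∑ i, (ρ * P i).trace.re = 1 := by
  constructor
  · intro i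
    obtain ⟨hH, hI, -⟩ := hP.1 i
    have h : (ρ * P i).trace = ((P i)ᴴ * ρ * P i).trace := by
      rw [Matrix.trace_mul_comm, hH.eq, Matrix.trace_mul_comm (P i * ρ), ← Matrix.mul_assoc, hI]
    rw [h]
    exact (Complex.le_def.1 (hρ.1.conjTranspose_mul_mul_same (P i)).trace_nonneg).1
  · rw [← Complex.re_sum, ← Matrix.trace_sum, ← Matrix.mul_sum, hP.2.2, Matrix.mul_one, hρ.2]
    simp

theorem shannon_mix {n : ℕ} (hn : 0 < n) (p q : Fin n → ℝ) (hp : ∀ i, 0 ≤ p i)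
    (hs : ∑ i, p i = 1) (hq : ∀ i, 0 ≤ q i) (hsq : ∑ i, q i = 1)
    (ε : ℝ) (hε0 : 0 ≤ ε) (hε1 : ε ≤ 1) :
    |shannon (fun i => (1 - ε) * p i + ε * q i) - shannon p| ≤
      ε * Real.logb 2 n + binEnt ε := by
  have a1 := shannon_le hn p hp hs
  have a2 := shannon_le hn q hq hsq
  have b1 := shannon_nonneg p hp hs
  have b2 := shannon_nonneg q hq hsq
  have hb : 0 ≤ binEnt ε :=
    add_nonneg (nml_nonneg hε0 hε1) (nml_nonneg (by linarith) (by linarith))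
  have lo : (1 - ε) * shannon p + ε * shannon q ≤
      shannon (fun i => (1 - ε) * p i + ε * q i) := by
    unfold shannon
    rw [Finset.mul_sum, Finset.mul_sum, ← Finset.sum_add_distrib]
    refine Finset.sum_le_sum fun i _ => ?_
    exact nml_concave.2 (hp i) (hq i) (by linarith) hε0 (by ring)
  have hi : shannon (fun i => (1 - ε) * p i + ε * q i) ≤
      (1 - ε) * shannon p + ε * shannon q + binEnt ε := by
    have e : (1 - ε) * shannon p + ε * shannon q + binEnt ε =
        ∑ i, (negMulLog2 ((1 - ε) * p i) + negMulLog2 (ε * q i)) := by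
      simp only [nml_mul, Finset.sum_add_distrib, ← Finset.sum_mul, ← Finset.mul_sum, hs, hsq]
      unfold shannon binEnt
      ring
    rw [e]
    exact Finset.sum_le_sum fun i _ =>
      nml_subadd (mul_nonneg (by linarith) (hp i)) (mul_nonneg hε0 (hq i))
  rw [abs_le]
  constructor <;> nlinarith

/-- Robustness at a fixed measurement: with M(τ,P) = inf_δ H(δ,P) − H(τ,P),
|M(ρ,P) − M((1−ε)ρ + εσ, P)| ≤ 4 ε log₂ d + H₂(ε). -/
theorem stmt18 {d : ℕ} (hd : 2 ≤ d) (ρ σ : Matrix (Fin d × Fin d) (Fin d × Fin d) ℂ)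
    (hρ : IsState ρ) (hσ : IsState σ)
    (P : Fin (d^2) → Matrix (Fin d × Fin d) (Fin d × Fin d) ℂ) (hP : IsMeasurement P)
    (ε : ℝ) (hε0 : 0 ≤ ε) (hε1 : ε ≤ 1) :
    |(infProd P - kleinEntropy ρ P) -
        (infProd P - kleinEntropy (((1 - ε : ℝ) : ℂ) • ρ + ((ε : ℝ) : ℂ) • σ) P)| ≤
      4 * ε * Real.logb 2 d + binEnt ε := by
  obtain ⟨hp, hs⟩ := probs ρ hρ P hP
  obtain ⟨hq, hsq⟩ := probs σ hσ P hP
  have hm := shannon_mix (n := d ^ 2) (by positivity) _ _ hp hs hq hsq ε hε0 hε1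
  have hk : kleinEntropy (((1 - ε : ℝ) : ℂ) • ρ + ((ε : ℝ) : ℂ) • σ) P =
      shannon (fun i => (1 - ε) * (ρ * P i).trace.re + ε * (σ * P i).trace.re) := by
    unfold kleinEntropy
    congr 1
    funext i
    rw [Matrix.add_mul, Matrix.smul_mul, Matrix.smul_mul, Matrix.trace_add, Matrix.trace_smul,
      Matrix.trace_smul, smul_eq_mul, smul_eq_mul, Complex.add_re, Complex.re_ofReal_mul,
      Complex.re_ofReal_mul]
  have hl : Real.logb 2 ((d ^ 2 : ℕ) : ℝ) = 2 * Real.logb 2 d := by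
    push_cast
    rw [Real.logb_pow]; norm_num
  have hl0 : 0 ≤ Real.logb 2 d :=
    Real.logb_nonneg (by norm_num) (by exact_mod_cast (by omega : 1 ≤ d))
  rw [sub_sub_sub_cancel_left, hk]
  rw [hl] at hm
  refine hm.trans ?_
  have := mul_nonneg hε0 hl0
  linarith

end EEP
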